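/- Let k ≥ 2 and consider the k-component Gaussian mixture density g(x; θ) = Σ_{ℓ=1}^k p_ℓ φ_{σ_ℓ}(x − μ_ℓ) with all parameters unknown, θ = (p₁, …, p_{k−1}, μ₁, …, μ_k, σ₁, …, σ_k) ranging over Θ = {p ∈ (0,1)^{k−1} : Σ_{j<k} p_j < 1} × ℝ^k × (0,∞)^k (with p_k = 1 − Σ_{j<k} p_j), and let I(θ) be the (3k−1)×(3k−1) Fisher information matrix with entries I_{ab}(θ) = ∫_ℝ (∂_a log g(x;θ))(∂_b log g(x;θ)) g(x;θ) dx. Then for any observations x₁, …, x_n ∈ ℝ, the posterior derived from the Jeffreys prior is improper: ∫_Θ [ Π_{i=1}^n g(x_i; θ) ] · √(det I(θ)) dθ = +∞. -/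

import Mathlib

open MeasureTheory

noncomputable section

/-- Density of a centered Gaussian with standard deviation `σ`. -/
def gaussPdf (σ x : ℝ) : ℝ :=
  (Real.sqrt (2 * Real.pi * σ ^ 2))⁻¹ * Real.exp (-(x ^ 2) / (2 * σ ^ 2))

/-- Full parameter of a `k = m + 2` component Gaussian mixture: the `k - 1` free
weights, the `k` means and the `k` standard deviations. -/
abbrev MixParam (m : ℕ) :=
  (Fin (m + 1) → ℝ) × (Fin (m + 2) → ℝ) × (Fin (m + 2) → ℝ)

/-- Extension of the free weights to the full weight vector, the last weight being
`1 - ∑_{j<k-1} p_j`. -/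
def fullWeight {m : ℕ} (q : Fin (m + 1) → ℝ) : Fin (m + 2) → ℝ :=
  Fin.snoc q (1 - ∑ j, q j)

/-- Gaussian mixture density with all parameters unknown. -/
def gaussMixAll {m : ℕ} (θ : MixParam m) (x : ℝ) : ℝ :=
  ∑ ℓ, fullWeight θ.1 ℓ * gaussPdf (θ.2.2 ℓ) (x - θ.2.1 ℓ)

/-- Index type for the `(3k - 1)` parameters. -/
abbrev MixIdx (m : ℕ) := Fin (m + 1) ⊕ (Fin (m + 2) ⊕ Fin (m + 2))

/-- Score function `∂_a log g(x; θ)` with respect to the `a`-th parameter. -/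
def mixScore {m : ℕ} (a : MixIdx m) (θ : MixParam m) (x : ℝ) : ℝ :=
  match a with
  | Sum.inl j =>
      deriv (fun t => Real.log (gaussMixAll (Function.update θ.1 j t, θ.2) x)) (θ.1 j)
  | Sum.inr (Sum.inl j) =>
      deriv (fun t =>
        Real.log (gaussMixAll (θ.1, Function.update θ.2.1 j t, θ.2.2) x)) (θ.2.1 j)
  | Sum.inr (Sum.inr j) =>
      deriv (fun t =>
        Real.log (gaussMixAll (θ.1, θ.2.1, Function.update θ.2.2 j t) x)) (θ.2.2 j)

/-- The `(3k-1) × (3k-1)` Fisher information matrix of the mixture with all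
parameters unknown: `I_{ab}(θ) = ∫ (∂_a log g)(∂_b log g) g dx`. -/
def mixFisher {m : ℕ} (θ : MixParam m) : Matrix (MixIdx m) (MixIdx m) ℝ := fun a b =>
  ∫ x : ℝ, mixScore a θ x * mixScore b θ x * gaussMixAll θ x

/-- The parameter space `Θ`: free weights in `(0,1)^{k-1}` with sum `< 1`, means in
`ℝ^k`, standard deviations in `(0,∞)^k`. -/
def mixParamSpace (m : ℕ) : Set (MixParam m) :=
  {θ | (∀ j, 0 < θ.1 j ∧ θ.1 j < 1) ∧ ∑ j, θ.1 j < 1 ∧ ∀ ℓ, 0 < θ.2.2 ℓ}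

theorem aux_det_lower {ι : Type} [Fintype ι] [DecidableEq ι] (M A : Matrix ι ι ℝ) (C : ℝ)
    (hC : 0 < C) (hM : M.IsHermitian) (hA : A.det ≠ 0)
    (h : ∀ v : ι → ℝ, ∑ b, (∑ a, v a * A a b) ^ 2 ≤ C * ∑ a, ∑ b, v a * M a b * v b) :
    (C⁻¹) ^ (Fintype.card ι) * A.det ^ 2 ≤ M.det := by
  classical
  have hu : IsUnit A.det := isUnit_iff_ne_zero.mpr hA
  set B := A⁻¹ with hB
  have hBA : B * A = 1 := Matrix.nonsing_inv_mul A hu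
  set P := B * M * B.transpose with hP
  have hPH : P.IsHermitian := by
    have := Matrix.isHermitian_mul_mul_conjTranspose B hM
    simpa [Matrix.conjTranspose_eq_transpose_of_trivial] using this
  have key : ∀ w : ι → ℝ, ∑ b, w b ^ 2 ≤ C * (w ⬝ᵥ P.mulVec w) := by
    intro w
    have h1 := h (Matrix.vecMul w B)
    have h2 : ∀ b, ∑ a, Matrix.vecMul w B a * A a b = w b := by
      intro b
      have : Matrix.vecMul (Matrix.vecMul w B) A b = w b := by
        rw [Matrix.vecMul_vecMul, hBA, Matrix.vecMul_one]
      simpa [Matrix.vecMul, dotProduct] using this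
    simp only [h2] at h1
    have h3 : ∑ a, ∑ b, Matrix.vecMul w B a * M a b * Matrix.vecMul w B b
        = w ⬝ᵥ P.mulVec w := by
      have : w ⬝ᵥ P.mulVec w = Matrix.vecMul w B ⬝ᵥ M.mulVec (Matrix.vecMul w B) := by
        rw [hP, ← Matrix.mulVec_mulVec, ← Matrix.mulVec_mulVec, Matrix.dotProduct_mulVec,
          Matrix.mulVec_transpose]
      rw [this]
      simp only [dotProduct, Matrix.mulVec, Finset.mul_sum, mul_assoc]
    rwa [h3] at h1
  have hev : ∀ i, C⁻¹ ≤ hPH.eigenvalues i := by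
    intro i
    have h1 := hPH.eigenvalues_eq i
    have h2 := key (hPH.eigenvectorBasis i).ofLp
    have h3 : ∑ b, (hPH.eigenvectorBasis i).ofLp b ^ 2 = 1 := by
      have := hPH.eigenvectorBasis.orthonormal.1 i
      rw [EuclideanSpace.norm_eq, Real.sqrt_eq_one] at this
      simpa using this
    rw [h3] at h2
    have h4 : hPH.eigenvalues i = (hPH.eigenvectorBasis i).ofLp ⬝ᵥ
        P.mulVec (hPH.eigenvectorBasis i).ofLp := by simpa using h1
    rw [← h4] at h2
    rw [inv_le_iff_one_le_mul₀ hC]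
    linarith
  have hdet : (C⁻¹) ^ (Fintype.card ι) ≤ P.det := by
    rw [hPH.det_eq_prod_eigenvalues]
    calc (C⁻¹) ^ (Fintype.card ι) = ∏ _i : ι, C⁻¹ := by simp
      _ ≤ _ := by
        apply Finset.prod_le_prod
        · intro i _; positivity
        · intro i _; simpa using hev i
  have hPd : P.det * A.det ^ 2 = M.det := by
    have : B.det * A.det = 1 := by rw [← Matrix.det_mul, hBA, Matrix.det_one]
    rw [hP, Matrix.det_mul, Matrix.det_mul, Matrix.det_transpose]
    linear_combination (B.det * A.det + 1) * M.det * this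
  rw [← hPd]
  gcongr

theorem aux_cs (f h g : ℝ → ℝ) (hg : ∀ x, 0 < g x)
    (i1 : Integrable (fun x => f x ^ 2 / g x)) (i2 : Integrable (fun x => h x * f x))
    (i3 : Integrable (fun x => h x ^ 2 * g x)) :
    (∫ x, h x * f x) ^ 2 ≤ (∫ x, h x ^ 2 * g x) * ∫ x, f x ^ 2 / g x := by
  have := discrim_le_zero (a := ∫ x, h x ^ 2 * g x) (b := -(2 * ∫ x, h x * f x))
    (c := ∫ x, f x ^ 2 / g x) (by
      intro t
      have e : (∫ x, h x ^ 2 * g x) * (t * t) + -(2 * ∫ x, h x * f x) * t + ∫ x, f x ^ 2 / g x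
          = ∫ x, (t * h x * g x - f x) ^ 2 / g x := by
        have : ∀ x, (t * h x * g x - f x) ^ 2 / g x
            = (t * t) * (h x ^ 2 * g x) + (-2 * t) * (h x * f x) + f x ^ 2 / g x := by
          intro x
          have := (hg x).ne'
          field_simp
          ring
        simp_rw [this]
        rw [integral_add, integral_add, integral_const_mul, integral_const_mul]
        · ring
        · exact i3.const_mul _
        · exact i2.const_mul _
        · exact (i3.const_mul _).add (i2.const_mul _)
        · exact i1
      rw [e]
      apply integral_nonneg
      intro x
      have := hg x
      simp only [Pi.zero_apply]
      positivity)
  rw [discrim] at this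
  nlinarith

theorem aux_gram {ι : Type} [Fintype ι] [DecidableEq ι] (f h : ι → ℝ → ℝ) (g : ℝ → ℝ)
    (hg : ∀ x, 0 < g x) (C : ℝ) (hC : 0 < C)
    (i1 : ∀ a b, Integrable (fun x => f a x * f b x / g x))
    (i2 : ∀ a b, Integrable (fun x => h b x * f a x))
    (i3 : ∀ b, Integrable (fun x => h b x ^ 2 * g x))
    (hb : ∑ b, ∫ x, h b x ^ 2 * g x ≤ C)
    (hA : (Matrix.of fun a b => ∫ x, h b x * f a x).det ≠ 0) :
    (C⁻¹) ^ (Fintype.card ι) * (Matrix.of fun a b => ∫ x, h b x * f a x).det ^ 2 ≤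
      (Matrix.of fun a b => ∫ x, f a x * f b x / g x).det := by
  apply aux_det_lower _ _ C hC _ hA
  · intro v
    have e1 : ∀ b, ∑ a, v a * ∫ x, h b x * f a x = ∫ x, h b x * ∑ a, v a * f a x := by
      intro b
      simp_rw [← integral_const_mul]
      rw [← integral_finsetSum _ (fun a _ => (i2 a b).const_mul _)]
      congr 1; ext x; rw [Finset.mul_sum]
      exact Finset.sum_congr rfl fun a _ => by ring
    have p2 : ∀ x, (∑ a, v a * f a x) ^ 2 / g x
        = ∑ a, ∑ b, (v a * v b) * (f a x * f b x / g x) := by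
      intro x
      rw [sq, Finset.sum_mul_sum, Finset.sum_div]
      refine Finset.sum_congr rfl fun a _ => ?_
      rw [Finset.sum_div]
      exact Finset.sum_congr rfl fun b _ => by ring
    have I1 : Integrable (fun x => (∑ a, v a * f a x) ^ 2 / g x) := by
      simp_rw [p2]
      exact integrable_finsetSum _ fun a _ => integrable_finsetSum _ fun b _ =>
        (i1 a b).const_mul _
    have e2 : ∑ a, ∑ b, v a * (∫ x, f a x * f b x / g x) * v b
        = ∫ x, (∑ a, v a * f a x) ^ 2 / g x := by
      simp_rw [p2]
      rw [integral_finsetSum _ (fun a _ => integrable_finsetSum _ fun b _ =>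
        (i1 a b).const_mul _)]
      refine Finset.sum_congr rfl fun a _ => ?_
      rw [integral_finsetSum _ (fun b _ => (i1 a b).const_mul _)]
      refine Finset.sum_congr rfl fun b _ => ?_
      rw [integral_const_mul]; ring
    have I2 : ∀ b, Integrable (fun x => h b x * ∑ a, v a * f a x) := by
      intro b
      have : ∀ x, h b x * ∑ a, v a * f a x = ∑ a, v a * (h b x * f a x) := by
        intro x; rw [Finset.mul_sum]; exact Finset.sum_congr rfl fun a _ => by ring
      simp_rw [this]
      exact integrable_finsetSum _ fun a _ => (i2 a b).const_mul _
    simp only [Matrix.of_apply]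
    rw [e2]
    simp_rw [e1]
    have nn : 0 ≤ ∫ x, (∑ a, v a * f a x) ^ 2 / g x := by
      apply integral_nonneg
      intro x
      have := hg x
      simp only [Pi.zero_apply]
      positivity
    calc _ ≤ ∑ b, (∫ x, h b x ^ 2 * g x) * ∫ x, (∑ a, v a * f a x) ^ 2 / g x :=
          Finset.sum_le_sum fun b _ => aux_cs _ _ _ hg I1 (I2 b) (i3 b)
      _ = (∑ b, ∫ x, h b x ^ 2 * g x) * ∫ x, (∑ a, v a * f a x) ^ 2 / g x := by
          rw [Finset.sum_mul]
      _ ≤ _ := by gcongr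
  · ext a b
    simp only [Matrix.conjTranspose_apply, Matrix.of_apply, star_trivial]
    congr 1; ext x; ring

theorem aux_det_cont {ι : Type} [Fintype ι] [DecidableEq ι] (A0 : Matrix ι ι ℝ)
    (h : A0.det ≠ 0) : ∃ ε > 0, ∀ M : Matrix ι ι ℝ, (∀ a b, |M a b - A0 a b| ≤ ε) →
      |A0.det| / 2 ≤ |M.det| := by
  have hc : Continuous (fun M : ι → ι → ℝ => |(Matrix.of M).det|) := by
    apply Continuous.abs
    apply Continuous.matrix_det
    exact continuous_id
  have h2 : |A0.det| / 2 < |(Matrix.of A0).det| := by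
    have := abs_pos.mpr h
    show |A0.det| / 2 < |A0.det|
    linarith
  have := (hc.tendsto A0).eventually (lt_mem_nhds h2)
  have := (Metric.eventually_nhds_iff (α := ι → ι → ℝ)).mp this
  obtain ⟨ε, hε, H⟩ := this
  refine ⟨ε / 2, by positivity, fun M hM => (H (y := M) ?_).le⟩
  refine lt_of_le_of_lt ?_ (half_lt_self hε)
  exact (dist_pi_le_iff (by positivity)).mpr fun a =>
    (dist_pi_le_iff (by positivity)).mpr fun b => hM a b

theorem gp_eq {σ : ℝ} (hσ : 0 < σ) (z : ℝ) : gaussPdf σ z = σ⁻¹ * gaussPdf 1 (z / σ) := by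
  unfold gaussPdf
  rw [Real.sqrt_mul (by positivity), Real.sqrt_sq hσ.le, one_pow, mul_one, mul_inv]
  have : -(z ^ 2) / (2 * σ ^ 2) = -((z / σ) ^ 2) / (2 * 1) := by field_simp
  rw [this]; ring

theorem gp_pos {σ : ℝ} (hσ : 0 < σ) (z : ℝ) : 0 < gaussPdf σ z := by
  unfold gaussPdf; positivity

theorem gp_cont (σ : ℝ) : Continuous (gaussPdf σ) := by
  unfold gaussPdf; fun_prop

theorem gp_one_mom (n : ℕ) : Integrable (fun y : ℝ => y ^ n * gaussPdf 1 y) := by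
  have := integrable_rpow_mul_exp_neg_mul_sq (b := 1 / 2) (by norm_num) (s := (n : ℝ))
    (by have : (0 : ℝ) ≤ n := by positivity
        linarith)
  have := this.const_mul (Real.sqrt (2 * Real.pi * 1 ^ 2))⁻¹
  refine this.congr (Filter.Eventually.of_forall fun y => ?_)
  simp only [gaussPdf, Real.rpow_natCast]
  rw [show -(y ^ 2) / (2 * 1 ^ 2) = -(1 / 2) * y ^ 2 by ring]
  ring

theorem gp_one_int : ∫ y, gaussPdf 1 y = 1 := by
  have := ProbabilityTheory.integral_gaussianPDFReal_eq_one 0 (v := 1) one_ne_zero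
  refine Eq.trans ?_ this
  congr 1; ext y
  simp [gaussPdf, ProbabilityTheory.gaussianPDFReal]

theorem gp_one_dom : Integrable (fun y : ℝ => (1 + y ^ 2) ^ 2 * gaussPdf 1 y) := by
  have := ((gp_one_mom 0).add ((gp_one_mom 2).const_mul 2)).add (gp_one_mom 4)
  refine this.congr (Filter.Eventually.of_forall fun y => ?_)
  simp only [Pi.add_apply]
  ring

def qf (r : Fin 3) (y : ℝ) : ℝ := if r = 0 then 1 else if r = 1 then y else y ^ 2 - 1

theorem qf_cont (r : Fin 3) : Continuous (qf r) := by
  unfold qf; split_ifs <;> fun_prop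

theorem qf_bd (r : Fin 3) (y : ℝ) : |qf r y| ≤ 1 + y ^ 2 := by
  unfold qf; split_ifs
  · rw [abs_one]; nlinarith [sq_nonneg y]
  · rw [abs_le]; constructor <;> nlinarith [sq_nonneg (y - 1), sq_nonneg (y + 1)]
  · rw [abs_le]; constructor <;> nlinarith [sq_nonneg y]

def Psi (σ μ : ℝ) (r : Fin 3) (x : ℝ) : ℝ := qf r ((x - μ) / σ) * gaussPdf σ (x - μ)

theorem Psi_cont (σ μ : ℝ) (r : Fin 3) : Continuous (Psi σ μ r) := by
  have := gp_cont σ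
  have := qf_cont r
  unfold Psi; fun_prop

theorem gp_dom {σ : ℝ} (hσ : 0 < σ) (μ : ℝ) :
    Integrable (fun x : ℝ => (1 + ((x - μ) / σ) ^ 2) ^ 2 * gaussPdf σ (x - μ)) := by
  have := ((gp_one_dom.comp_div hσ.ne').comp_sub_right μ).const_mul σ⁻¹
  refine this.congr (Filter.Eventually.of_forall fun y => ?_)
  simp only [gp_eq hσ]
  ring

theorem Psi_int {σ : ℝ} (hσ : 0 < σ) (μ : ℝ) (r : Fin 3) : Integrable (Psi σ μ r) := by
  refine (gp_dom hσ μ).mono' (Psi_cont σ μ r).aestronglyMeasurable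
    (Filter.Eventually.of_forall fun x => ?_)
  have h1 := qf_bd r ((x - μ) / σ)
  have h2 := gp_pos hσ (x - μ)
  rw [Real.norm_eq_abs, Psi, abs_mul, abs_of_pos h2]
  gcongr
  refine h1.trans ?_
  nlinarith [sq_nonneg ((x - μ) / σ), sq_nonneg (((x - μ) / σ) ^ 2)]

theorem Psi_sq_int {σ : ℝ} (hσ : 0 < σ) (μ : ℝ) (r : Fin 3) (g : ℝ → ℝ) (hgc : Continuous g)
    (p : ℝ) (hp : 0 < p) (hg : ∀ x, p * gaussPdf σ (x - μ) ≤ g x) (hg0 : ∀ x, 0 < g x) :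
    Integrable (fun x => Psi σ μ r x ^ 2 / g x) := by
  refine ((gp_dom hσ μ).const_mul p⁻¹).mono' ?_ (Filter.Eventually.of_forall fun x => ?_)
  · exact (((Psi_cont σ μ r).pow 2).div hgc fun x => (hg0 x).ne').aestronglyMeasurable
  have h1 := qf_bd r ((x - μ) / σ)
  have h2 := gp_pos hσ (x - μ)
  have h0 := hg0 x
  rw [Real.norm_eq_abs, abs_of_nonneg (by positivity), div_le_iff₀ h0]
  have h3 : Psi σ μ r x ^ 2 ≤ ((1 + ((x - μ) / σ) ^ 2) * gaussPdf σ (x - μ)) ^ 2 := by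
    rw [← sq_abs, Psi, abs_mul, abs_of_pos h2]
    gcongr
  refine h3.trans ?_
  calc ((1 + ((x - μ) / σ) ^ 2) * gaussPdf σ (x - μ)) ^ 2
      = p⁻¹ * ((1 + ((x - μ) / σ) ^ 2) ^ 2 * gaussPdf σ (x - μ)) * (p * gaussPdf σ (x - μ)) := by
        field_simp
    _ ≤ _ := by gcongr; exact hg x

theorem gp_int {σ : ℝ} (hσ : 0 < σ) (μ : ℝ) : ∫ x, gaussPdf σ (x - μ) = 1 := by
  rw [integral_sub_right_eq_self (fun x => gaussPdf σ x) μ]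
  simp_rw [gp_eq hσ]
  rw [integral_const_mul, Measure.integral_comp_div, gp_one_int, abs_of_pos hσ]
  simp [hσ.ne']

theorem gp_intble {σ : ℝ} (hσ : 0 < σ) (μ : ℝ) : Integrable (fun x => gaussPdf σ (x - μ)) := by
  have := Psi_int hσ μ 0
  refine this.congr (Filter.Eventually.of_forall fun y => ?_)
  simp [Psi, qf]

theorem gp_deriv_mu (σ μ x : ℝ) (hσ : 0 < σ) :
    HasDerivAt (fun t => gaussPdf σ (x - t)) (σ⁻¹ * Psi σ μ 1 x) μ := by
  unfold Psi gaussPdf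
  have h1 : HasDerivAt (fun t : ℝ => -((x - t) ^ 2) / (2 * σ ^ 2))
      ((x - μ) / σ ^ 2) μ := by
    have := (((((hasDerivAt_id μ).const_sub x).fun_pow 2).fun_neg)).div_const (2 * σ ^ 2)
    refine this.congr_deriv ?_
    simp; field_simp
  refine ((h1.exp).const_mul (Real.sqrt (2 * Real.pi * σ ^ 2))⁻¹).congr_deriv ?_
  simp only [qf, Fin.isValue, one_ne_zero, if_false, if_true]; field_simp

theorem gp_deriv_sigma (σ z : ℝ) (hσ : 0 < σ) :
    HasDerivAt (fun s => gaussPdf s z) (σ⁻¹ * (((z / σ) ^ 2 - 1) * gaussPdf σ z)) σ := by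
  have h1 : HasDerivAt (fun s : ℝ => s⁻¹ * ((Real.sqrt (2 * Real.pi))⁻¹ *
      Real.exp (-(z ^ 2) / 2 * (s⁻¹) ^ 2)))
      (σ⁻¹ * (((z / σ) ^ 2 - 1) * gaussPdf σ z)) σ := by
    have hi := hasDerivAt_inv hσ.ne'
    have h2 := (((hi.fun_pow 2).const_mul (-(z ^ 2) / 2)).exp).const_mul (Real.sqrt (2 * Real.pi))⁻¹
    refine (hi.fun_mul h2).congr_deriv ?_
    rw [gp_eq hσ, gaussPdf]
    have : -(z / σ) ^ 2 / (2 * 1 ^ 2) = -(z ^ 2) / 2 * (σ⁻¹) ^ 2 := by field_simp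
    rw [this]
    simp only [one_pow, mul_one, show (2 - 1 : ℕ) = 1 from rfl, pow_one, Nat.cast_ofNat]
    generalize Real.exp _ = E
    field_simp
    ring
  refine h1.congr_of_eventuallyEq ?_
  filter_upwards [lt_mem_nhds hσ] with s hs
  rw [gp_eq hs, gaussPdf]
  have : -(z / s) ^ 2 / (2 * 1 ^ 2) = -(z ^ 2) / 2 * (s⁻¹) ^ 2 := by field_simp
  rw [this]; simp

def hp (c : ℝ) (i : Fin 3) (y : ℝ) : ℝ := if i = 0 then 1 else if i = 1 then y else y ^ 2 - c

def hF (c : ℝ) (i : Fin 3) (y : ℝ) : ℝ := (Set.Icc (-1 : ℝ) 1).indicator (hp c i) y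

theorem hp_cont (c : ℝ) (i : Fin 3) : Continuous (hp c i) := by
  unfold hp; split_ifs <;> fun_prop

theorem hF_meas (c : ℝ) (i : Fin 3) : Measurable (hF c i) :=
  (hp_cont c i).measurable.indicator measurableSet_Icc

theorem hF_bd (c : ℝ) (hc0 : 0 ≤ c) (hc1 : c ≤ 1) (i : Fin 3) (y : ℝ) : |hF c i y| ≤ 1 := by
  unfold hF Set.indicator
  split_ifs with h
  · obtain ⟨h1, h2⟩ := h
    unfold hp
    split_ifs
    · simp
    · exact abs_le.mpr ⟨h1, h2⟩
    · have : y ^ 2 ≤ 1 := by nlinarith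
      exact abs_le.mpr ⟨by nlinarith [sq_nonneg y], by linarith⟩
  · simp

def bet (c : ℝ) (i r : Fin 3) : ℝ := ∫ y, hF c i y * (qf r y * gaussPdf 1 y)

theorem bet_eq (c : ℝ) (i r : Fin 3) :
    bet c i r = ∫ y in (-1 : ℝ)..1, hp c i y * (qf r y * gaussPdf 1 y) := by
  rw [intervalIntegral.integral_of_le (by norm_num), ← integral_Icc_eq_integral_Ioc,
    ← integral_indicator measurableSet_Icc, bet]
  congr 1; ext y
  unfold hF Set.indicator
  split_ifs <;> simp

theorem bet_cont (c : ℝ) (i r : Fin 3) :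
    Continuous (fun y => hp c i y * (qf r y * gaussPdf 1 y)) :=
  (hp_cont c i).mul ((qf_cont r).mul (gp_cont 1))

theorem gp_even (y : ℝ) : gaussPdf 1 (-y) = gaussPdf 1 y := by simp [gaussPdf]

theorem odd_zero (f : ℝ → ℝ) (hf : ∀ y, f (-y) = - f y) : ∫ y in (-1 : ℝ)..1, f y = 0 := by
  have := intervalIntegral.integral_comp_neg (a := -1) (b := 1) f
  simp only [hf, intervalIntegral.integral_neg, neg_neg] at this
  linarith

theorem bet10 (c : ℝ) : bet c 1 0 = 0 := by
  rw [bet_eq]; apply odd_zero; intro y; simp [hp, qf, gp_even]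

theorem bet21 (c : ℝ) : bet c 2 1 = 0 := by
  rw [bet_eq]; apply odd_zero; intro y; simp [hp, qf, gp_even]

theorem bet00 (c : ℝ) : 0 < bet c 0 0 := by
  rw [bet_eq]
  refine intervalIntegral.integral_pos (by norm_num) (bet_cont _ _ _).continuousOn ?_
    ⟨0, by norm_num, ?_⟩
  · intro y _; simpa [hp, qf] using (gp_pos one_pos y).le
  · simpa [hp, qf] using (gp_pos one_pos 0)

theorem bet11 (c : ℝ) : 0 < bet c 1 1 := by
  rw [bet_eq]
  refine intervalIntegral.integral_pos (by norm_num) (bet_cont _ _ _).continuousOn ?_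
    ⟨1, by norm_num, ?_⟩
  · intro y _
    have := (gp_pos one_pos y)
    simp only [hp, qf, Fin.isValue, one_ne_zero, if_false, if_true]
    nlinarith [mul_nonneg (sq_nonneg y) this.le]
  · simpa [hp, qf] using (gp_pos one_pos 1)

theorem exists_c : ∃ c : ℝ, 0 ≤ c ∧ c ≤ 1 ∧ bet c 2 0 = 0 ∧ 0 < bet c 2 2 := by
  have c1 : Continuous (gaussPdf 1) := gp_cont 1
  have c2 : Continuous (fun y => y ^ 2 * gaussPdf 1 y) := by fun_prop
  set N := ∫ y in (-1 : ℝ)..1, y ^ 2 * gaussPdf 1 y with hN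
  set D := ∫ y in (-1 : ℝ)..1, gaussPdf 1 y with hD
  have hDp : 0 < D := by
    have := bet00 0
    rw [bet_eq] at this
    simpa [hp, qf] using this
  have hNn : 0 ≤ N := by
    apply intervalIntegral.integral_nonneg (by norm_num)
    intro y _
    have := gp_pos one_pos y
    positivity
  have hND : N ≤ D := by
    apply intervalIntegral.integral_mono_on (by norm_num) (c2.intervalIntegrable _ _)
      (c1.intervalIntegrable _ _)
    intro y hy
    have := gp_pos one_pos y
    have : y ^ 2 ≤ 1 := by nlinarith [hy.1, hy.2]
    nlinarith
  have h20 : ∫ y in (-1 : ℝ)..1, (y ^ 2 - N / D) * gaussPdf 1 y = 0 := by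
    simp_rw [sub_mul]
    rw [intervalIntegral.integral_sub (c2.intervalIntegrable _ _)
      ((c1.const_mul _).intervalIntegrable _ _), intervalIntegral.integral_const_mul, ← hN, ← hD]
    field_simp; ring
  refine ⟨N / D, by positivity, (div_le_one hDp).mpr hND, ?_, ?_⟩
  · rw [bet_eq, ← h20]
    congr 1; ext y; simp [hp, qf]
  · rw [bet_eq]
    generalize N / D = c at *
    have e : (fun y : ℝ => hp c 2 y * (qf 2 y * gaussPdf 1 y)) = fun y =>
        (y ^ 2 - c) ^ 2 * gaussPdf 1 y + (c - 1) * ((y ^ 2 - c) * gaussPdf 1 y) := by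
      ext y; simp [hp, qf]; ring
    have c3 : Continuous (fun y => (y ^ 2 - c) ^ 2 * gaussPdf 1 y) := by fun_prop
    have c4 : Continuous (fun y => (y ^ 2 - c) * gaussPdf 1 y) := by fun_prop
    rw [e, intervalIntegral.integral_add (c3.intervalIntegrable _ _)
      ((c4.const_mul _).intervalIntegrable _ _), intervalIntegral.integral_const_mul, h20,
      mul_zero, add_zero]
    have hnn : ∀ y, 0 ≤ (y ^ 2 - c) ^ 2 * gaussPdf 1 y := fun y => by
      have := gp_pos one_pos y
      positivity
    by_cases hc : c = 0
    · refine intervalIntegral.integral_pos (by norm_num) c3.continuousOn (fun y _ => hnn y)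
        ⟨1, by norm_num, ?_⟩
      have := gp_pos one_pos 1
      subst hc; simpa using this
    · refine intervalIntegral.integral_pos (by norm_num) c3.continuousOn (fun y _ => hnn y)
        ⟨0, by norm_num, ?_⟩
      have := gp_pos one_pos 0
      have : 0 < c ^ 2 := by positivity
      simp; positivity

theorem K_same {σ : ℝ} (hσ : 0 < σ) (μ c : ℝ) (i r : Fin 3) :
    ∫ x, hF c i ((x - μ) / σ) * Psi σ μ r x = bet c i r := by
  unfold Psi
  rw [integral_sub_right_eq_self (fun x => hF c i (x / σ) * (qf r (x / σ) * gaussPdf σ x)) μ]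
  simp_rw [gp_eq hσ]
  rw [Measure.integral_comp_div (fun y => hF c i y * (qf r y * (σ⁻¹ * gaussPdf 1 y))) σ, bet,
    smul_eq_mul, ← integral_const_mul]
  congr 1; ext y
  rw [abs_of_pos hσ]; field_simp

theorem gp_le_one {σ : ℝ} (hσ : 1 ≤ σ) (z : ℝ) :
    gaussPdf σ z ≤ Real.exp (-((z / σ) ^ 2) / 2) := by
  rw [gp_eq (by linarith), gaussPdf]
  have h1 : σ⁻¹ ≤ 1 := inv_le_one_of_one_le₀ hσ
  have h2 : (Real.sqrt (2 * Real.pi * 1 ^ 2))⁻¹ ≤ 1 := by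
    apply inv_le_one_of_one_le₀
    rw [Real.one_le_sqrt]
    nlinarith [Real.pi_gt_three]
  rw [show -(z / σ) ^ 2 / (2 * 1 ^ 2) = -((z / σ) ^ 2) / 2 by ring]
  have h3 := Real.exp_pos (-((z / σ) ^ 2) / 2)
  have h0 : 0 ≤ σ⁻¹ := by positivity
  calc _ ≤ 1 * (1 * Real.exp (-((z / σ) ^ 2) / 2)) := by gcongr
    _ = _ := by ring

theorem Psi_small {σ : ℝ} (hσ : 1 ≤ σ) (μ x : ℝ) (r : Fin 3) (Y : ℝ) (hY : 1 ≤ Y)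
    (h : Y ≤ |(x - μ) / σ|) : |Psi σ μ r x| ≤ 16 / Y := by
  have h1 := qf_bd r ((x - μ) / σ)
  have h2 := gp_pos (by linarith : 0 < σ) (x - μ)
  have h3 := gp_le_one hσ (x - μ)
  rw [Psi, abs_mul, abs_of_pos h2]
  set y := (x - μ) / σ
  have hy2 : Y ^ 2 ≤ y ^ 2 := by rw [← sq_abs y]; gcongr
  have hy1 : 1 ≤ y ^ 2 := by nlinarith
  have h4 : Real.exp (-(y ^ 2) / 2) ≤ 8 / (y ^ 2) ^ 2 := by
    have := Real.quadratic_le_exp_of_nonneg (x := y ^ 2 / 2) (by positivity)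
    rw [show -(y ^ 2) / 2 = -(y ^ 2 / 2) by ring, Real.exp_neg]
    rw [inv_le_comm₀ (Real.exp_pos _) (by positivity), inv_div]
    nlinarith
  calc |qf r y| * gaussPdf σ (x - μ) ≤ (1 + y ^ 2) * (8 / (y ^ 2) ^ 2) := by
        gcongr; exact h3.trans h4
    _ ≤ (y ^ 2 + y ^ 2) * (8 / (y ^ 2) ^ 2) := by gcongr
    _ = 16 / y ^ 2 := by field_simp; ring
    _ ≤ 16 / Y := by
      gcongr
      nlinarith

theorem K_diff (c : ℝ) (hc0 : 0 ≤ c) (hc1 : c ≤ 1) (i r : Fin 3) (σ τ μ ν Y : ℝ)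
    (hσ : 1 ≤ σ) (hσ2 : σ ≤ 2) (hτ : 1 ≤ τ) (hτ2 : τ ≤ 2) (hY : 1 ≤ Y)
    (hsep : 2 * Y + 2 ≤ |μ - ν|) :
    |∫ x, hF c i ((x - ν) / τ) * Psi σ μ r x| ≤ 64 / Y := by
  have e : ∀ x, x ∉ Set.Icc (ν - 2) (ν + 2) → hF c i ((x - ν) / τ) * Psi σ μ r x = 0 := by
    intro x hx
    have : (x - ν) / τ ∉ Set.Icc (-1 : ℝ) 1 := by
      rintro ⟨h1, h2⟩
      apply hx
      rw [div_le_iff₀ (by linarith)] at h2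
      rw [le_div_iff₀ (by linarith)] at h1
      constructor <;> linarith
    rw [hF, Set.indicator_of_notMem this, zero_mul]
  rw [← setIntegral_eq_integral_of_forall_compl_eq_zero e]
  have := norm_setIntegral_le_of_norm_le_const (μ := volume) (s := Set.Icc (ν - 2) (ν + 2))
    (f := fun x => hF c i ((x - ν) / τ) * Psi σ μ r x) (C := 16 / Y) (by simp) (by
      intro x hx
      rw [norm_mul, Real.norm_eq_abs, Real.norm_eq_abs]
      have h1 := hF_bd c hc0 hc1 i ((x - ν) / τ)
      have h2 := Psi_small hσ μ x r Y hY (by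
        rw [abs_div, abs_of_pos (by linarith : 0 < σ), le_div_iff₀ (by linarith)]
        have h3 : |μ - ν| ≤ |x - μ| + |x - ν| := by
          rw [show μ - ν = (x - ν) - (x - μ) by ring]
          have := abs_sub (x - ν) (x - μ)
          linarith
        have h4 : |x - ν| ≤ 2 := abs_le.mpr ⟨by linarith [hx.1], by linarith [hx.2]⟩
        nlinarith)
      calc _ ≤ 1 * (16 / Y) := by gcongr
        _ = _ := one_mul _)
  rw [Real.norm_eq_abs] at this
  refine this.trans (le_of_eq ?_)
  rw [Measure.real, Real.volume_Icc, ENNReal.toReal_ofReal (by linarith)]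
  ring

def fS {m : ℕ} (θ : MixParam m) : MixIdx m → ℝ → ℝ
  | Sum.inl j => fun x => Psi (θ.2.2 j.castSucc) (θ.2.1 j.castSucc) 0 x
      - Psi (θ.2.2 (Fin.last _)) (θ.2.1 (Fin.last _)) 0 x
  | Sum.inr (Sum.inl j) => fun x =>
      (fullWeight θ.1 j * (θ.2.2 j)⁻¹) * Psi (θ.2.2 j) (θ.2.1 j) 1 x
  | Sum.inr (Sum.inr j) => fun x =>
      (fullWeight θ.1 j * (θ.2.2 j)⁻¹) * Psi (θ.2.2 j) (θ.2.1 j) 2 x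

theorem mix_cont {m : ℕ} (θ : MixParam m) : Continuous (gaussMixAll θ) := by
  have := fun σ => gp_cont σ
  unfold gaussMixAll
  fun_prop

theorem mix_ge {m : ℕ} (θ : MixParam m) (hw : ∀ l, 0 < fullWeight θ.1 l)
    (hs : ∀ l, 0 < θ.2.2 l) (l : Fin (m + 2)) (x : ℝ) :
    fullWeight θ.1 l * gaussPdf (θ.2.2 l) (x - θ.2.1 l) ≤ gaussMixAll θ x := by
  unfold gaussMixAll
  exact Finset.single_le_sum
    (f := fun l => fullWeight θ.1 l * gaussPdf (θ.2.2 l) (x - θ.2.1 l))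
    (fun l _ => (mul_pos (hw l) (gp_pos (hs l) _)).le) (Finset.mem_univ l)

theorem mix_pos {m : ℕ} (θ : MixParam m) (hw : ∀ l, 0 < fullWeight θ.1 l)
    (hs : ∀ l, 0 < θ.2.2 l) (x : ℝ) : 0 < gaussMixAll θ x :=
  (mul_pos (hw 0) (gp_pos (hs 0) _)).trans_le (mix_ge θ hw hs 0 x)

theorem mix_int {m : ℕ} (θ : MixParam m) (hs : ∀ l, 0 < θ.2.2 l) :
    Integrable (gaussMixAll θ) := by
  unfold gaussMixAll
  exact integrable_finsetSum _ fun l _ => (gp_intble (hs l) _).const_mul _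

theorem mix_integral {m : ℕ} (θ : MixParam m) (hs : ∀ l, 0 < θ.2.2 l) :
    ∫ x, gaussMixAll θ x = 1 := by
  unfold gaussMixAll
  rw [integral_finsetSum _ fun l _ => (gp_intble (hs l) _).const_mul _]
  simp_rw [integral_const_mul, gp_int (hs _)]
  simp [fullWeight, Fin.sum_univ_castSucc]

theorem score_eq {m : ℕ} (θ : MixParam m) (hw : ∀ l, 0 < fullWeight θ.1 l)
    (hs : ∀ l, 0 < θ.2.2 l) (a : MixIdx m) (x : ℝ) :
    mixScore a θ x = fS θ a x / gaussMixAll θ x := by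
  have hg := (mix_pos θ hw hs x).ne'
  rcases a with j | j | j
  · have hd : HasDerivAt (fun t => gaussMixAll (Function.update θ.1 j t, θ.2) x)
        (fS θ (Sum.inl j) x) (θ.1 j) := by
      have e : ∀ t, gaussMixAll (Function.update θ.1 j t, θ.2) x =
          ∑ i, Function.update θ.1 j t i *
            gaussPdf (θ.2.2 i.castSucc) (x - θ.2.1 i.castSucc)
          + (1 - ∑ i, Function.update θ.1 j t i) *
            gaussPdf (θ.2.2 (Fin.last _)) (x - θ.2.1 (Fin.last _)) := by
        intro t
        unfold gaussMixAll
        rw [Fin.sum_univ_castSucc]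
        simp only [fullWeight, Fin.snoc_castSucc, Fin.snoc_last]
      simp_rw [e]
      have hu : ∀ i, HasDerivAt (fun t => Function.update θ.1 j t i)
          (if i = j then 1 else 0) (θ.1 j) := by
        intro i
        by_cases h : i = j
        · subst h; simpa using hasDerivAt_id' _
        · simpa [Function.update_of_ne h, h] using hasDerivAt_const _ _
      have h1 := HasDerivAt.fun_sum (u := Finset.univ) fun i _ => (hu i).mul_const
        (gaussPdf (θ.2.2 i.castSucc) (x - θ.2.1 i.castSucc))
      have h2 := ((HasDerivAt.fun_sum (u := Finset.univ) fun i _ => hu i).const_sub 1).mul_const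
        (gaussPdf (θ.2.2 (Fin.last _)) (x - θ.2.1 (Fin.last _)))
      refine (h1.add h2).congr_deriv ?_
      simp [fS, Psi, qf, sub_eq_add_neg]
    have := (hd.log (by simpa using hg)).deriv
    simpa [mixScore] using this
  · have hd : HasDerivAt (fun t => gaussMixAll (θ.1, Function.update θ.2.1 j t, θ.2.2) x)
        (fS θ (Sum.inr (Sum.inl j)) x) (θ.2.1 j) := by
      unfold gaussMixAll
      have h1 : ∀ l, HasDerivAt (fun t => fullWeight θ.1 l *
          gaussPdf (θ.2.2 l) (x - Function.update θ.2.1 j t l))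
          (if l = j then fS θ (Sum.inr (Sum.inl j)) x else 0) (θ.2.1 j) := by
        intro l
        by_cases h : l = j
        · subst h
          simp only [Function.update_self, if_true]
          refine ((gp_deriv_mu _ _ x (hs l)).const_mul _).congr_deriv ?_
          simp [fS]; ring
        · simpa [Function.update_of_ne h, h] using hasDerivAt_const _ _
      refine (HasDerivAt.fun_sum (u := Finset.univ) fun i _ => h1 i).congr_deriv ?_
      simp
    have := (hd.log (by simpa using hg)).deriv
    simpa [mixScore] using this
  · have hd : HasDerivAt (fun t => gaussMixAll (θ.1, θ.2.1, Function.update θ.2.2 j t) x)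
        (fS θ (Sum.inr (Sum.inr j)) x) (θ.2.2 j) := by
      unfold gaussMixAll
      have h1 : ∀ l, HasDerivAt (fun t => fullWeight θ.1 l *
          gaussPdf (Function.update θ.2.2 j t l) (x - θ.2.1 l))
          (if l = j then fS θ (Sum.inr (Sum.inr j)) x else 0) (θ.2.2 j) := by
        intro l
        by_cases h : l = j
        · subst h
          simp only [Function.update_self, if_true]
          refine ((gp_deriv_sigma _ (x - θ.2.1 l) (hs l)).const_mul _).congr_deriv ?_
          simp [fS, Psi, qf]; ring
        · simpa [Function.update_of_ne h, h] using hasDerivAt_const _ _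
      refine (HasDerivAt.fun_sum (u := Finset.univ) fun i _ => h1 i).congr_deriv ?_
      simp
    have := (hd.log (by simpa using hg)).deriv
    simpa [mixScore] using this

theorem fS_cont {m : ℕ} (θ : MixParam m) (a : MixIdx m) : Continuous (fS θ a) := by
  have := fun σ μ r => Psi_cont σ μ r
  rcases a with j | j | j <;> unfold fS <;> fun_prop

theorem fS_int {m : ℕ} (θ : MixParam m) (hs : ∀ l, 0 < θ.2.2 l) (a : MixIdx m) :
    Integrable (fS θ a) := by
  rcases a with j | j | j <;> unfold fS
  · exact (Psi_int (hs _) _ _).sub (Psi_int (hs _) _ _)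
  · exact (Psi_int (hs _) _ _).const_mul _
  · exact (Psi_int (hs _) _ _).const_mul _

theorem fS_sq_int {m : ℕ} (θ : MixParam m) (hw : ∀ l, 0 < fullWeight θ.1 l)
    (hs : ∀ l, 0 < θ.2.2 l) (a : MixIdx m) :
    Integrable (fun x => fS θ a x ^ 2 / gaussMixAll θ x) := by
  have hP : ∀ l r, Integrable (fun x => Psi (θ.2.2 l) (θ.2.1 l) r x ^ 2 / gaussMixAll θ x) :=
    fun l r => Psi_sq_int (hs l) _ r _ (mix_cont θ) _ (hw l) (mix_ge θ hw hs l) (mix_pos θ hw hs)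
  rcases a with j | j | j
  · refine (((hP j.castSucc 0).const_mul 2).add ((hP (Fin.last _) 0).const_mul 2)).mono'
      (((fS_cont θ _).pow 2).div (mix_cont θ)
        fun x => (mix_pos θ hw hs x).ne').aestronglyMeasurable
      (Filter.Eventually.of_forall fun x => ?_)
    have h0 := mix_pos θ hw hs x
    rw [Real.norm_eq_abs, abs_of_nonneg (by positivity)]
    simp only [Pi.add_apply, fS]
    generalize Psi _ _ _ _ = A
    generalize Psi _ _ _ _ = B
    rw [← mul_div_assoc, ← mul_div_assoc, ← add_div]
    gcongr
    nlinarith [sq_nonneg (A + B)]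
  · refine ((hP j 1).const_mul ((fullWeight θ.1 j * (θ.2.2 j)⁻¹) ^ 2)).congr
      (Filter.Eventually.of_forall fun x => ?_)
    simp only [fS]; ring
  · refine ((hP j 2).const_mul ((fullWeight θ.1 j * (θ.2.2 j)⁻¹) ^ 2)).congr
      (Filter.Eventually.of_forall fun x => ?_)
    simp only [fS]; ring

theorem fS_mul_int {m : ℕ} (θ : MixParam m) (hw : ∀ l, 0 < fullWeight θ.1 l)
    (hs : ∀ l, 0 < θ.2.2 l) (a b : MixIdx m) :
    Integrable (fun x => fS θ a x * fS θ b x / gaussMixAll θ x) := by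
  refine ((fS_sq_int θ hw hs a).add (fS_sq_int θ hw hs b)).mono'
      (((fS_cont θ a).mul (fS_cont θ b)).div (mix_cont θ)
        fun x => (mix_pos θ hw hs x).ne').aestronglyMeasurable
      (Filter.Eventually.of_forall fun x => ?_)
  have h0 := mix_pos θ hw hs x
  rw [Real.norm_eq_abs, abs_div, abs_of_pos h0]
  simp only [Pi.add_apply]
  rw [← add_div]
  gcongr
  rw [abs_le]
  constructor <;> nlinarith [sq_nonneg (fS θ a x + fS θ b x), sq_nonneg (fS θ a x - fS θ b x),
    sq_nonneg (fS θ a x), sq_nonneg (fS θ b x)]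

theorem fisher_eq {m : ℕ} (θ : MixParam m) (hw : ∀ l, 0 < fullWeight θ.1 l)
    (hs : ∀ l, 0 < θ.2.2 l) :
    mixFisher θ = Matrix.of fun a b => ∫ x, fS θ a x * fS θ b x / gaussMixAll θ x := by
  ext a b
  simp only [mixFisher, Matrix.of_apply]
  congr 1; ext x
  have := (mix_pos θ hw hs x).ne'
  rw [score_eq θ hw hs, score_eq θ hw hs]
  field_simp

/-- component attached to an index -/
def cpt {m : ℕ} : MixIdx m → Fin (m + 2)
  | Sum.inl j => j.castSucc
  | Sum.inr (Sum.inl j) => j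
  | Sum.inr (Sum.inr j) => j

def typ {m : ℕ} : MixIdx m → Fin 3
  | Sum.inl _ => 0
  | Sum.inr (Sum.inl _) => 1
  | Sum.inr (Sum.inr _) => 2

def hS (c : ℝ) {m : ℕ} (θ : MixParam m) (b : MixIdx m) (x : ℝ) : ℝ :=
  hF c (typ b) ((x - θ.2.1 (cpt b)) / θ.2.2 (cpt b))

def dd (c : ℝ) {m : ℕ} (b : MixIdx m) (l : Fin (m + 2)) (r : Fin 3) : ℝ :=
  if cpt b = l then bet c (typ b) r else 0

def A0 (c : ℝ) {m : ℕ} : Matrix (MixIdx m) (MixIdx m) ℝ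
  | Sum.inl j, b => dd c b j.castSucc 0 - dd c b (Fin.last _) 0
  | Sum.inr (Sum.inl j), b => dd c b j 1
  | Sum.inr (Sum.inr j), b => dd c b j 2

theorem A0_det (c : ℝ) (h20 : bet c 2 0 = 0) (h22 : 0 < bet c 2 2) {m : ℕ} :
    (A0 c (m := m)).det ≠ 0 := by
  have e : A0 c (m := m) = Matrix.fromBlocks (Matrix.diagonal fun _ => bet c 0 0) 0
      (Matrix.of fun a b => A0 c (m := m) (Sum.inr a) (Sum.inl b))
      (Matrix.fromBlocks (Matrix.diagonal fun _ => bet c 1 1) 0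
        (Matrix.of fun a b => A0 c (m := m) (Sum.inr (Sum.inr a)) (Sum.inr (Sum.inl b)))
        (Matrix.diagonal fun _ => bet c 2 2)) := by
    ext a b
    rcases a with a | a | a <;> rcases b with b | b | b <;>
      simp [A0, dd, cpt, typ, h20, bet10, bet21, Matrix.diagonal_apply, eq_comm]
  rw [e, Matrix.det_fromBlocks_zero₁₂, Matrix.det_fromBlocks_zero₁₂, Matrix.det_diagonal,
    Matrix.det_diagonal, Matrix.det_diagonal]
  have := bet00 c
  have := bet11 c
  simp only [Finset.prod_const]
  positivity

/-- row scaling -/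
def rs {m : ℕ} (θ : MixParam m) : MixIdx m → ℝ
  | Sum.inl _ => 1
  | Sum.inr (Sum.inl j) => fullWeight θ.1 j * (θ.2.2 j)⁻¹
  | Sum.inr (Sum.inr j) => fullWeight θ.1 j * (θ.2.2 j)⁻¹

def fN {m : ℕ} (θ : MixParam m) : MixIdx m → ℝ → ℝ
  | Sum.inl j => fun x => Psi (θ.2.2 j.castSucc) (θ.2.1 j.castSucc) 0 x
      - Psi (θ.2.2 (Fin.last _)) (θ.2.1 (Fin.last _)) 0 x
  | Sum.inr (Sum.inl j) => fun x => Psi (θ.2.2 j) (θ.2.1 j) 1 x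
  | Sum.inr (Sum.inr j) => fun x => Psi (θ.2.2 j) (θ.2.1 j) 2 x

theorem fS_eq {m : ℕ} (θ : MixParam m) (a : MixIdx m) (x : ℝ) :
    fS θ a x = rs θ a * fN θ a x := by
  rcases a with j | j | j <;> simp [fS, rs, fN]

theorem hS_mul_int (c : ℝ) (hc0 : 0 ≤ c) (hc1 : c ≤ 1) {m : ℕ} (θ : MixParam m) (b : MixIdx m)
    (f : ℝ → ℝ) (hf : Integrable f) : Integrable (fun x => hS c θ b x * f x) := by
  refine hf.bdd_mul (c := 1) ?_ (Filter.Eventually.of_forall fun x => hF_bd c hc0 hc1 _ _)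
  unfold hS
  have := hF_meas c (typ b)
  exact (this.comp (by fun_prop)).aestronglyMeasurable

theorem A_close (c : ℝ) (hc0 : 0 ≤ c) (hc1 : c ≤ 1) {m : ℕ} (θ : MixParam m)
    (Y : ℝ) (hY : 1 ≤ Y) (hs1 : ∀ l, 1 ≤ θ.2.2 l) (hs2 : ∀ l, θ.2.2 l ≤ 2)
    (hsep : ∀ l l', l ≠ l' → 2 * Y + 2 ≤ |θ.2.1 l - θ.2.1 l'|) (a b : MixIdx m) :
    |(∫ x, hS c θ b x * fN θ a x) - A0 c a b| ≤ 128 / Y := by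
  have hs : ∀ l, 0 < θ.2.2 l := fun l => by linarith [hs1 l]
  have hK : ∀ l r, |(∫ x, hS c θ b x * Psi (θ.2.2 l) (θ.2.1 l) r x) - dd c b l r| ≤ 64 / Y := by
    intro l r
    unfold hS dd
    by_cases h : cpt b = l
    · rw [if_pos h, h, K_same (hs l), sub_self, abs_zero]; positivity
    · rw [if_neg h, sub_zero]
      exact K_diff c hc0 hc1 _ _ _ _ _ _ Y (hs1 _) (hs2 _) (hs1 _) (hs2 _) hY
        (hsep _ _ (Ne.symm h))
  have hY2 : 64 / Y ≤ 128 / Y := by gcongr; norm_num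
  rcases a with j | j | j
  · simp only [fN, A0, mul_sub]
    rw [integral_sub (hS_mul_int c hc0 hc1 θ b _ (Psi_int (hs _) _ _))
      (hS_mul_int c hc0 hc1 θ b _ (Psi_int (hs _) _ _))]
    have h1 := abs_le.mp (hK j.castSucc 0)
    have h2 := abs_le.mp (hK (Fin.last _) 0)
    have : 128 / Y = 64 / Y + 64 / Y := by ring
    rw [abs_le]; constructor <;> linarith
  · exact (hK j 1).trans hY2
  · exact (hK j 2).trans hY2

theorem det_lower (m : ℕ) : ∃ R > 0, ∃ δ > 0, ∀ θ : MixParam m,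
    (∀ l, 1 / (2 * (m + 2) : ℝ) ≤ fullWeight θ.1 l) → (∀ l, 1 ≤ θ.2.2 l) → (∀ l, θ.2.2 l ≤ 2) →
    (∀ l l', l ≠ l' → R ≤ |θ.2.1 l - θ.2.1 l'|) → δ ≤ (mixFisher θ).det := by
  obtain ⟨c, hc0, hc1, h20, h22⟩ := exists_c
  have hA0 := A0_det c h20 h22 (m := m)
  obtain ⟨ε, hε, H⟩ := aux_det_cont _ hA0
  set Y := 1 + 128 / ε with hYd
  have hY : 1 ≤ Y := by have : 0 ≤ 128 / ε := by positivity
                        linarith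
  have hYε : 128 / Y ≤ ε := by
    rw [div_le_iff₀ (by linarith), hYd, mul_add, mul_div_cancel₀ _ hε.ne']
    linarith
  set N : ℕ := Fintype.card (MixIdx m) with hN
  have hNp : 0 < (N : ℝ) := by
    rw [hN]; exact_mod_cast Fintype.card_pos
  set e : ℝ := 1 / (4 * (m + 2) : ℝ)
  have he : 0 < e := by positivity
  have he1 : e ≤ 1 := by
    rw [div_le_one (by positivity)]
    have : (0 : ℝ) ≤ m := by positivity
    linarith
  have hA0p := abs_pos.mpr hA0
  refine ⟨2 * Y + 2, by linarith, ((N : ℝ)⁻¹) ^ N * (e ^ N * (|(A0 c (m := m)).det| / 2)) ^ 2,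
    by positivity, ?_⟩
  intro θ hw1 hs1 hs2 hsep
  have hw : ∀ l, 0 < fullWeight θ.1 l := fun l => lt_of_lt_of_le (by positivity) (hw1 l)
  have hs : ∀ l, 0 < θ.2.2 l := fun l => by linarith [hs1 l]
  have hM := H (Matrix.of fun a b => ∫ x, hS c θ b x * fN θ a x) fun a b =>
    (A_close c hc0 hc1 θ Y hY hs1 hs2 hsep a b).trans hYε
  have hmat : (Matrix.of fun a b => ∫ x, hS c θ b x * fS θ a x) = Matrix.of fun a b =>
      rs θ a * (Matrix.of fun a b => ∫ x, hS c θ b x * fN θ a x) a b := by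
    ext a b
    simp only [Matrix.of_apply]
    rw [← integral_const_mul]
    congr 1; ext x; rw [fS_eq]; ring
  have hrs : ∀ a, e ≤ rs θ a := by
    have : ∀ j, e ≤ fullWeight θ.1 j * (θ.2.2 j)⁻¹ := by
      intro j
      have h1 : (2 : ℝ)⁻¹ ≤ (θ.2.2 j)⁻¹ := inv_anti₀ (hs j) (hs2 j)
      calc e = 1 / (2 * (m + 2) : ℝ) * 2⁻¹ := by simp only [e]; field_simp; norm_num
        _ ≤ _ := mul_le_mul (hw1 j) h1 (by norm_num) (hw j).le
    intro a
    rcases a with j | j | j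
    · exact he1
    · exact this j
    · exact this j
  have hdet : e ^ N * (|(A0 c (m := m)).det| / 2) ≤
      |(Matrix.of fun a b => ∫ x, hS c θ b x * fS θ a x).det| := by
    rw [hmat, Matrix.det_mul_column, abs_mul, Finset.abs_prod]
    refine mul_le_mul ?_ hM (by positivity) (by positivity)
    calc e ^ N = ∏ _a : MixIdx m, e := by rw [Finset.prod_const, hN, Finset.card_univ]
      _ ≤ _ := Finset.prod_le_prod (fun _ _ => he.le) fun a _ => (hrs a).trans (le_abs_self _)
  have hi3 : ∀ b, Integrable (fun x => hS c θ b x ^ 2 * gaussMixAll θ x) := by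
    intro b
    have := hS_mul_int c hc0 hc1 θ b _ (hS_mul_int c hc0 hc1 θ b _ (mix_int θ hs))
    refine this.congr (Filter.Eventually.of_forall fun x => ?_)
    simp only; ring
  have hb : ∑ b, ∫ x, hS c θ b x ^ 2 * gaussMixAll θ x ≤ N := by
    calc _ ≤ ∑ _b : MixIdx m, (1 : ℝ) := by
          refine Finset.sum_le_sum fun b _ => ?_
          rw [← mix_integral θ hs]
          refine integral_mono (hi3 b) (mix_int θ hs) fun x => ?_
          have h1 := mix_pos θ hw hs x
          have h2 : hS c θ b x ^ 2 ≤ 1 := by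
            rw [← sq_abs]
            have := hF_bd c hc0 hc1 (typ b) ((x - θ.2.1 (cpt b)) / θ.2.2 (cpt b))
            exact pow_le_one₀ (abs_nonneg _) this
          simp only
          nlinarith
      _ = N := by simp [hN]
  have hG := aux_gram (fS θ) (hS c θ) (gaussMixAll θ) (mix_pos θ hw hs) N hNp
    (fS_mul_int θ hw hs) (fun a b => hS_mul_int c hc0 hc1 θ b _ (fS_int θ hs a)) hi3 hb
    (by
      rw [← abs_pos]
      exact lt_of_lt_of_le (by positivity) hdet)
  rw [fisher_eq θ hw hs]
  refine le_trans ?_ hG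
  rw [← sq_abs (Matrix.det _)]
  gcongr

/-- for a Gaussian mixture with `k = m + 2 ≥ 2` components and all
parameters unknown, and for any observations `x₁, …, xₙ`, the posterior derived
from the Jeffreys prior `√(det I(θ))` is improper:
`∫_Θ (∏ᵢ g(xᵢ; θ)) √(det I(θ)) dθ = +∞`. -/
theorem posterior_all_params_jeffreys_improper (m n : ℕ) (x : Fin n → ℝ) :
    (∫⁻ θ : MixParam m in mixParamSpace m,
        ENNReal.ofReal
          ((∏ i, gaussMixAll θ (x i)) * Real.sqrt (mixFisher θ).det)) = ⊤ := by
  obtain ⟨R, hR, δ, hδ, H⟩ := det_lower m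
  have hk : (0 : ℝ) < m + 2 := by positivity
  set u : ℝ := 1 / (2 * (m + 2) : ℝ) with hu
  set w : ℝ := 1 / (m + 2 : ℝ) with hw
  have hu0 : 0 < u := by positivity
  have huw : u < w := by
    rw [hu, hw]; exact one_div_lt_one_div_of_lt hk (by linarith)
  set S1 : Set (Fin (m + 1) → ℝ) := Set.univ.pi fun _ => Set.Ioo u w
  set S2 : Set (Fin (m + 2) → ℝ) := Set.univ.pi fun l =>
    if l = Fin.last _ then Set.Ioi (2 * R * (l : ℕ)) else
      Set.Ioo (2 * R * (l : ℕ)) (2 * R * (l : ℕ) + R)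
  set S3 : Set (Fin (m + 2) → ℝ) := Set.univ.pi fun _ => Set.Ioo 1 2
  set S : Set (MixParam m) := S1 ×ˢ S2 ×ˢ S3 with hS
  have hvol : volume S = ⊤ := by
    rw [hS, Measure.volume_eq_prod, Measure.prod_prod, Measure.volume_eq_prod, Measure.prod_prod]
    have v1 : volume S1 ≠ 0 := by
      rw [volume_pi_pi, Finset.prod_ne_zero_iff]
      intro i _; simp [huw]
    have v3 : volume S3 ≠ 0 := by
      rw [volume_pi_pi, Finset.prod_ne_zero_iff]
      intro i _; rw [Real.volume_Ioo]; norm_num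
    have v2 : volume S2 = ⊤ := by
      rw [volume_pi_pi, Fin.prod_univ_castSucc]
      simp only [if_true, Real.volume_Ioi]
      apply ENNReal.mul_top
      rw [Finset.prod_ne_zero_iff]
      intro i _
      rw [if_neg (Fin.castSucc_lt_last i).ne, Real.volume_Ioo]
      simp [hR]
    rw [v2, ENNReal.top_mul v3, ENNReal.mul_top v1]
  have hmS : MeasurableSet S := by
    refine (MeasurableSet.univ_pi fun _ => measurableSet_Ioo).prod
      ((MeasurableSet.univ_pi fun l => ?_).prod (MeasurableSet.univ_pi fun _ => measurableSet_Ioo))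
    split_ifs
    · exact measurableSet_Ioi
    · exact measurableSet_Ioo
  have hfw : ∀ θ ∈ S, (∑ j, θ.1 j < 1) ∧ ∀ l, u ≤ fullWeight θ.1 l := by
    rintro θ ⟨h1, -, -⟩
    have hsum : ∑ j, θ.1 j ≤ (m + 1) * w := by
      calc _ ≤ ∑ _j : Fin (m + 1), w := Finset.sum_le_sum fun j _ => (h1 j trivial).2.le
        _ = _ := by simp
    have hw1 : (m + 2) * w = 1 := by rw [hw]; field_simp
    refine ⟨by nlinarith, fun l => ?_⟩
    refine Fin.lastCases ?_ (fun j => ?_) l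
    · simp only [fullWeight, Fin.snoc_last]; nlinarith
    · simp only [fullWeight, Fin.snoc_castSucc]; exact (h1 j trivial).1.le
  have hsub : S ⊆ mixParamSpace m := by
    intro θ hθ
    have hw1 : w ≤ 1 := by
      rw [hw, div_le_one hk]
      have : (0 : ℝ) ≤ m := by positivity
      linarith
    refine ⟨fun j => ⟨?_, ?_⟩, (hfw θ hθ).1, fun l => ?_⟩
    · exact hu0.trans (hθ.1 j trivial).1
    · exact (hθ.1 j trivial).2.trans_le hw1
    · exact one_pos.trans (hθ.2.2 l trivial).1
  have hdet : ∀ θ ∈ S, δ ≤ (mixFisher θ).det := by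
    intro θ hθ
    have hlt : ∀ l l' : Fin (m + 2), l < l' → R ≤ θ.2.1 l' - θ.2.1 l := by
      intro l l' hl
      have hne : l ≠ Fin.last _ := (hl.trans_le (Fin.le_last l')).ne
      have h1 := hθ.2.1 l trivial
      simp only [if_neg hne] at h1
      have h2 : 2 * R * (l' : ℕ) < θ.2.1 l' := by
        have := hθ.2.1 l' trivial
        by_cases h : l' = Fin.last _
        · simp only [if_pos h] at this; exact this
        · simp only [if_neg h] at this; exact this.1
      have h3 : ((l : ℕ) : ℝ) + 1 ≤ (l' : ℕ) := by exact_mod_cast hl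
      have h4 := h1.2
      nlinarith
    refine H θ (hfw θ hθ).2 (fun l => (hθ.2.2 l trivial).1.le)
      (fun l => (hθ.2.2 l trivial).2.le) ?_
    intro l l' hne
    rcases lt_or_gt_of_ne hne with h | h
    · rw [abs_sub_comm]; exact (hlt _ _ h).trans (le_abs_self _)
    · exact (hlt _ _ h).trans (le_abs_self _)
  set κ : ℝ → ℝ := fun z => u * (2⁻¹ * ((Real.sqrt (2 * Real.pi * 1 ^ 2))⁻¹ *
    Real.exp (-((|z| + R) ^ 2) / (2 * 1 ^ 2))))
  have hκ : ∀ z, 0 < κ z := fun z => by positivity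
  have hlik : ∀ θ ∈ S, ∀ z, κ z ≤ gaussMixAll θ z := by
    intro θ hθ z
    have hw' := (hfw θ hθ).2
    have hs1 := (hθ.2.2 0 trivial).1
    have hs2 := (hθ.2.2 0 trivial).2
    have hmu := hθ.2.1 0 trivial
    have hne : (0 : Fin (m + 2)) ≠ Fin.last _ := (Fin.last_pos).ne
    simp only [if_neg hne, Fin.val_zero, Nat.cast_zero, mul_zero, zero_add] at hmu
    refine le_trans ?_ (mix_ge θ (fun l => hu0.trans_le (hw' l))
      (fun l => one_pos.trans (hθ.2.2 l trivial).1) 0 z)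
    have hs0 : 0 < θ.2.2 0 := one_pos.trans hs1
    refine mul_le_mul (hw' 0) ?_ (by positivity) (hu0.trans_le (hw' 0)).le
    rw [gp_eq hs0, gaussPdf]
    have h1 : (2 : ℝ)⁻¹ ≤ (θ.2.2 0)⁻¹ := inv_anti₀ hs0 hs2.le
    have h2 : ((z - θ.2.1 0) / θ.2.2 0) ^ 2 ≤ (|z| + R) ^ 2 := by
      rw [← sq_abs]
      gcongr
      rw [abs_div, abs_of_pos hs0]
      refine (div_le_self (abs_nonneg _) hs1.le).trans ?_
      refine (abs_sub _ _).trans ?_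
      rw [abs_of_pos hmu.1]
      linarith [hmu.2]
    gcongr
  set c0 : ℝ := (∏ i, κ (x i)) * Real.sqrt δ with hc0
  have hc0p : 0 < c0 := mul_pos (Finset.prod_pos fun i _ => hκ _) (Real.sqrt_pos.mpr hδ)
  rw [eq_top_iff]
  calc (⊤ : ENNReal) = ENNReal.ofReal c0 * volume S := by
        rw [hvol, ENNReal.mul_top]
        simpa using hc0p
    _ = ∫⁻ _θ in S, ENNReal.ofReal c0 := by rw [setLIntegral_const]
    _ ≤ ∫⁻ θ in S, ENNReal.ofReal
          ((∏ i, gaussMixAll θ (x i)) * Real.sqrt (mixFisher θ).det) := by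
        refine setLIntegral_mono' hmS fun θ hθ => ?_
        apply ENNReal.ofReal_le_ofReal
        refine mul_le_mul ?_ (Real.sqrt_le_sqrt (hdet θ hθ)) (Real.sqrt_nonneg _) ?_
        · exact Finset.prod_le_prod (fun i _ => (hκ _).le) fun i _ => hlik θ hθ _
        · exact Finset.prod_nonneg fun i _ => (hκ _).le.trans (hlik θ hθ _)
    _ ≤ _ := lintegral_mono_set hsub
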